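/- Let T ≥ B ≥ 1 and α ≥ 2 be integers. Consider the set of all integers T₂ for which there exist a finite field F_q, positive integers k, n with k/n ≥ T/(T+B), and a streaming code with source alphabet F_q^k and channel alphabet F_q^n that corrects erasure bursts of length B with delay T and also corrects erasure bursts of length αB with delay T₂. This set has a least element, and the least element is T₂* = αT + B. -/

import Mathlib

/-- The channel input stream produced by the streaming code `f` (a sequence of causal
encoding functions `f t : S^(t+1) → X`) from the source stream `s`. -/
def chanStream {S X : Type*} (f : ∀ t : ℕ, (Fin (t + 1) → S) → X) (s : ℕ → S) (t : ℕ) : X :=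
  f t fun i => s i.val

/-- Output at time `t` of the burst-erasure channel with burst length `B` and burst starting
position `j`: `none` (an erasure) for `j ≤ t ≤ j + B - 1`, and the channel input otherwise. -/
def burstOut {S X : Type*} (f : ∀ t : ℕ, (Fin (t + 1) → S) → X) (B j : ℕ) (s : ℕ → S)
    (t : ℕ) : Option X :=
  if j ≤ t ∧ t ≤ j + B - 1 then none else some (chanStream f s t)

/-- The streaming code `f` corrects erasure bursts of length `B` with delay `T`: there are
decoding functions `γ t` recovering `s t` from the channel outputs `y 0, …, y (t + T)`,
for every source stream `s` and every burst starting position `j`. -/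
def Corrects {S X : Type*} (f : ∀ t : ℕ, (Fin (t + 1) → S) → X) (B T : ℕ) : Prop :=
  ∃ γ : ∀ t : ℕ, (Fin (t + T + 1) → Option X) → S,
    ∀ (s : ℕ → S) (j t : ℕ), γ t (fun i => burstOut f B j s i.val) = s t

theorem corrects_iff {S X : Type*} [Nonempty S] (f : ∀ t : ℕ, (Fin (t + 1) → S) → X) (B T : ℕ)
    (hB : 1 ≤ B) :
    Corrects f B T ↔ ∀ (s s' : ℕ → S) (j t : ℕ),
      (∀ i, i ≤ t + T → (i < j ∨ j + B ≤ i) → chanStream f s i = chanStream f s' i) →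
      s t = s' t := by
  classical
  constructor
  · rintro ⟨γ, hγ⟩ s s' j t h
    rw [← hγ s j t, ← hγ s' j t]
    congr 1
    funext i
    unfold burstOut
    split_ifs with hc
    · rfl
    · rw [h i.val (by have := i.isLt; omega) (by omega)]
  · intro h
    refine ⟨fun t y => if hy : ∃ (s : ℕ → S) (j : ℕ),
      y = (fun i : Fin (t + T + 1) => burstOut f B j s i.val) then hy.choose t
      else Classical.arbitrary S, ?_⟩
    intro s j t
    have hy : ∃ (s' : ℕ → S) (j' : ℕ),
      (fun i : Fin (t + T + 1) => burstOut f B j s i.val) =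
        (fun i : Fin (t + T + 1) => burstOut f B j' s' i.val) := ⟨s, j, rfl⟩
    dsimp only
    rw [dif_pos hy]
    obtain ⟨j', hj'⟩ := hy.choose_spec
    symm
    apply h s _ j t
    intro i hi hij
    have := congrFun hj' ⟨i, by omega⟩
    simp only [burstOut] at this
    rw [if_neg (by omega)] at this
    split_ifs at this with hc
    exact Option.some.inj this

theorem chan_congr {S X : Type*} (f : ∀ t : ℕ, (Fin (t + 1) → S) → X) (s s' : ℕ → S) (t : ℕ)
    (h : ∀ i, i ≤ t → s i = s' i) : chanStream f s t = chanStream f s' t := by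
  unfold chanStream
  congr 1
  funext i
  exact h i.val (by have := i.isLt; omega)

theorem periodic_claim {S X : Type*} [Nonempty S] (f : ∀ t : ℕ, (Fin (t + 1) → S) → X)
    (B T β P : ℕ) (hB : 1 ≤ B) (hBT : B ≤ T) (hβ : 1 ≤ β)
    (hP : P + 1 = (β + 1) * (T + B))
    (h1 : Corrects f B T) (h2 : Corrects f ((β + 1) * B) ((β + 1) * T + B - 1))
    (s s' : ℕ → S) (m : ℕ)
    (H : ∀ r i, r ≤ m → (β + 1) * B ≤ i → i < P →
      chanStream f s (r * P + i) = chanStream f s' (r * P + i)) :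
    ∀ r, r ≤ m → (∀ t, t < r * P + (β + 1) * B → s t = s' t) ∧
      (∀ i, i < (r + 1) * P → chanStream f s i = chanStream f s' i) := by
  have e1 : (β + 1) * B = β * B + B := by ring
  have e2 : (β + 1) * T = β * T + T := by ring
  have e3 : (β + 1) * (T + B) = β * T + T + β * B + B := by ring
  have e4 : 1 * T ≤ β * T := Nat.mul_le_mul_right _ hβ
  rw [corrects_iff f _ _ hB] at h1
  rw [corrects_iff f _ _ (by nlinarith)] at h2
  have step : ∀ r, r ≤ m → (∀ i, i < r * P → chanStream f s i = chanStream f s' i) →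
      (∀ t, t < r * P + (β + 1) * B → s t = s' t) ∧
      (∀ i, i < (r + 1) * P → chanStream f s i = chanStream f s' i) := by
    intro r hr hc
    have e5 : (r + 1) * P = r * P + P := by ring
    have Hr : ∀ i, r * P + (β + 1) * B ≤ i → i < r * P + P →
        chanStream f s i = chanStream f s' i := by
      intro i hi hi'
      have := H r (i - r * P) hr (by omega) (by omega)
      rwa [show r * P + (i - r * P) = i by omega] at this
    have a1 : ∀ t, t < r * P + β * B → s t = s' t := by
      intro t ht
      apply h2 s s' (r * P) t
      intro i hi hij
      rcases hij with hij | hij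
      · exact hc i hij
      · exact Hr i hij (by omega)
    have a2 : ∀ i, i < r * P + β * B → chanStream f s i = chanStream f s' i := by
      intro i hi
      exact chan_congr f s s' i (fun i' hi' => a1 i' (by omega))
    have a3 : ∀ t, t < r * P + (β + 1) * B → s t = s' t := by
      intro t ht
      apply h1 s s' (r * P + β * B) t
      intro i hi hij
      rcases hij with hij | hij
      · exact a2 i hij
      · exact Hr i (by omega) (by omega)
    refine ⟨a3, ?_⟩
    intro i hi
    by_cases hi2 : i < r * P + (β + 1) * B
    · exact chan_congr f s s' i (fun i' hi' => a3 i' (by omega))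
    · exact Hr i (by omega) (by omega)
  intro r
  induction r with
  | zero => intro hr; exact step 0 hr (by simp)
  | succ r ih => intro hr; exact step (r + 1) hr (ih (by omega)).2

theorem converse_aux (B T β : ℕ) (hB : 1 ≤ B) (hBT : B ≤ T) (hβ : 1 ≤ β)
    (F : Type) [Field F] [Fintype F] (k n : ℕ) (hn : 0 < n)
    (hrate : T * n ≤ k * (T + B))
    (f : ∀ t : ℕ, (Fin (t + 1) → (Fin k → F)) → (Fin n → F))
    (h1 : Corrects f B T) (h2 : Corrects f ((β + 1) * B) ((β + 1) * T + B - 1)) : False := by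
  classical
  obtain ⟨P, hP⟩ : ∃ P, P + 1 = (β + 1) * (T + B) :=
    ⟨(β + 1) * (T + B) - 1, Nat.sub_add_cancel (by nlinarith)⟩
  obtain ⟨W, hW⟩ : ∃ W, W + 1 = (β + 1) * T :=
    ⟨(β + 1) * T - 1, Nat.sub_add_cancel (by nlinarith)⟩
  have hPW : P = (β + 1) * B + W := by nlinarith
  have key : ∀ m : ℕ, k * (m * P) ≤ n * ((m + 1) * W) := by
    intro m
    let ext : (Fin (m * P) → (Fin k → F)) → ℕ → (Fin k → F) :=
      fun v t => if h : t < m * P then v ⟨t, h⟩ else 0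
    let G : (Fin (m * P) → (Fin k → F)) → (Fin (m + 1) × Fin W → (Fin n → F)) :=
      fun v ri => chanStream f (ext v) (ri.1.val * P + ((β + 1) * B + ri.2.val))
    have hG : Function.Injective G := by
      intro v v' hv
      have := (periodic_claim f B T β P hB hBT hβ hP h1 h2 (ext v) (ext v') m (by
        intro r i hr hi hi'
        have := congrFun hv (⟨r, by omega⟩, ⟨i - (β + 1) * B, by omega⟩)
        simp only [G] at this
        rwa [show (β + 1) * B + (i - (β + 1) * B) = i by omega] at this) m le_rfl).1
      funext t
      have ht := this t.val (by have := t.isLt; omega)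
      simpa [ext] using ht
    have hc := Fintype.card_le_of_injective G hG
    simp only [Fintype.card_pi, Finset.prod_const, Finset.card_univ, Fintype.card_fin,
      Fintype.card_prod] at hc
    rw [← pow_mul, ← pow_mul] at hc
    exact (Nat.pow_le_pow_iff_right (Fintype.one_lt_card)).1 hc
  have hk := key ((T + B) * ((β + 1) * T))
  set m := (T + B) * ((β + 1) * T) with hm
  have hk2 : T * (m * P) ≤ (T + B) * ((m + 1) * W) := by
    have : n * (T * (m * P)) ≤ n * ((T + B) * ((m + 1) * W)) := by
      calc n * (T * (m * P)) = (T * n) * (m * P) := by ring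
        _ ≤ (k * (T + B)) * (m * P) := Nat.mul_le_mul_right _ hrate
        _ = (T + B) * (k * (m * P)) := by ring
        _ ≤ (T + B) * (n * ((m + 1) * W)) := Nat.mul_le_mul_left _ hk
        _ = _ := by ring
    exact Nat.le_of_mul_le_mul_left this hn
  zify at hk2 hm hP hW hB
  have hP' : (P : ℤ) = (β + 1) * (T + B) - 1 := by linarith
  have hW' : (W : ℤ) = (β + 1) * T - 1 := by linarith
  have e : (m : ℤ) * B ≤ (T + B) * W := by
    have : (T : ℤ) * (m * P) - (T + B) * (m * W) = m * B := by rw [hP', hW']; ring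
    nlinarith
  have hm0 : (0 : ℤ) ≤ m := by positivity
  have : (m : ℤ) ≤ (T + B) * W := by nlinarith
  rw [hW', hm] at this
  nlinarith

/-- Coefficients of a systematic Reed-Solomon code with `K` information symbols. -/
noncomputable def rsCoef (F : Type) [Field F] (K m j : ℕ) : F :=
  (Lagrange.basis (Finset.range K) (fun i : ℕ => (i : F)) m).eval ((K + j : ℕ) : F)

theorem rs_mds (F : Type) [Field F] (K B : ℕ)
    (hinj : Set.InjOn (fun i : ℕ => (i : F)) (Finset.range (K + B) : Set ℕ))
    (M J : Finset ℕ) (hM : M ⊆ Finset.range K) (hJ : J ⊆ Finset.range B)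
    (hcard : M.card ≤ J.card) (x : ℕ → F) (hx : ∀ m, m < K → m ∉ M → x m = 0)
    (h : ∀ j ∈ J, ∑ m ∈ Finset.range K, rsCoef F K m j * x m = 0) :
    ∀ m, m < K → x m = 0 := by
  classical
  have hinjK : Set.InjOn (fun i : ℕ => (i : F)) (Finset.range K : Set ℕ) := by
    apply hinj.mono
    intro i hi
    simp only [Finset.coe_range, Set.mem_Iio] at hi ⊢
    omega
  let s : Finset ℕ := (Finset.range K \ M) ∪ J.image (fun j => K + j)
  have hs : s ⊆ Finset.range (K + B) := by
    intro i hi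
    simp only [s, Finset.mem_union, Finset.mem_sdiff, Finset.mem_image, Finset.mem_range] at hi ⊢
    rcases hi with hi | ⟨j, hj, rfl⟩
    · omega
    · have := Finset.mem_range.1 (hJ hj)
      omega
  have hsc : K ≤ s.card := by
    have hd : Disjoint (Finset.range K \ M) (J.image (fun j => K + j)) := by
      rw [Finset.disjoint_left]
      intro i hi hi'
      simp only [Finset.mem_sdiff, Finset.mem_image, Finset.mem_range] at hi hi'
      obtain ⟨j, hj, rfl⟩ := hi'
      omega
    rw [Finset.card_union_of_disjoint hd, Finset.card_sdiff_of_subset hM,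
      Finset.card_image_of_injective _ (fun a b hab => by simpa using hab), Finset.card_range]
    have := Finset.card_le_card hM
    rw [Finset.card_range] at this
    omega
  have hP0 : Lagrange.interpolate (Finset.range K) (fun i : ℕ => (i : F)) x = 0 := by
    apply Polynomial.eq_zero_of_degree_lt_of_eval_index_eq_zero (s := s) (v := fun i : ℕ => (i : F))
      (hinj.mono (Finset.coe_subset.2 hs))
    · refine lt_of_lt_of_le (Lagrange.degree_interpolate_lt x hinjK) ?_
      rw [Finset.card_range]
      exact_mod_cast hsc
    · intro i hi
      simp only [s, Finset.mem_union, Finset.mem_sdiff, Finset.mem_image, Finset.mem_range] at hi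
      rcases hi with ⟨hi, hi'⟩ | ⟨j, hj, rfl⟩
      · rw [Lagrange.eval_interpolate_at_node x hinjK (Finset.mem_range.2 hi)]
        exact hx i hi hi'
      · rw [Lagrange.interpolate_apply, Polynomial.eval_finset_sum, ← h j hj]
        apply Finset.sum_congr rfl
        intro m _
        rw [Polynomial.eval_mul, Polynomial.eval_C, rsCoef, mul_comm]
  intro m hm
  rw [← Lagrange.eval_interpolate_at_node x hinjK (Finset.mem_range.2 hm), hP0,
    Polynomial.eval_zero]

/-- Burst correction of the non-urgent symbols `a B, …, a (T-1)`. -/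
theorem v_lemma (F : Type) [Field F] (T B : ℕ) (hBT : B ≤ T)
    (hinj : Set.InjOn (fun i : ℕ => (i : F)) (Finset.range (T - B + B) : Set ℕ))
    (a : ℕ → F) (e : ℤ)
    (h0 : ∀ j, j < B → (j : ℤ) < e → a j = 0)
    (h1 : ∀ k, B ≤ k → k < T → (k : ℤ) < e → a k = 0)
    (h2 : ∀ k, B ≤ k → k < T → e + B ≤ (k : ℤ) → a k = 0)
    (h3 : ∀ j, j < B → e + B - T ≤ (j : ℤ) → (j : ℤ) < e →
      a j + ∑ m ∈ Finset.range (T - B), rsCoef F (T - B) m j * a (B + m) = 0) :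
    ∀ k, B ≤ k → k < T → a k = 0 := by
  rcases lt_or_ge e 0 with he | he
  · intro k hk hk'
    exact h2 k hk hk' (by omega)
  obtain ⟨e, rfl⟩ := Int.eq_ofNat_of_zero_le he
  have := rs_mds F (T - B) B hinj (Finset.Ico (e - B) (min (T - B) e))
    (Finset.Ico (e + B - T) (min B e))
    (by intro i hi; simp only [Finset.mem_Ico, Finset.mem_range] at hi ⊢; omega)
    (by intro i hi; simp only [Finset.mem_Ico, Finset.mem_range] at hi ⊢; omega)
    (by simp only [Nat.card_Ico]; omega) (fun m => a (B + m))
    (by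
      intro m hm hm'
      simp only [Finset.mem_Ico, not_and, not_lt] at hm'
      by_cases hme : B + m < e
      · exact h1 _ (by omega) (by omega) (by omega)
      · exact h2 _ (by omega) (by omega) (by omega))
    (by
      intro j hj
      simp only [Finset.mem_Ico] at hj
      have := h3 j (by omega) (by omega) (by omega)
      rwa [h0 j (by omega) (by omega), zero_add] at this)
  intro k hk hk'
  have := this (k - B) (by omega)
  simpa [show B + (k - B) = k by omega] using this

/-- Parity stream of the first (diagonally interleaved) code. -/
noncomputable def par1 {F : Type} [Field F] (T B : ℕ) (D : ℤ → ℕ → F) (j : ℕ) (i : ℤ) : F :=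
  D (i - T) j + ∑ m ∈ Finset.range (T - B),
    rsCoef F (T - B) m j * D (i - T - j + (B + m : ℕ)) (B + m)

/-- Parity stream of the second code, interleaved with step `β` along the opposite diagonal. -/
noncomputable def par2 {F : Type} [Field F] (T B β : ℕ) (D : ℤ → ℕ → F) (j : ℕ) (i : ℤ) : F :=
  D (i - β * T) (T - 1 - j) + ∑ m ∈ Finset.range (T - B),
    rsCoef F (T - B) m j * D (i - β * (T + j) + β * (B + m : ℕ)) (T - 1 - (B + m))

/-- The combined parity. -/
noncomputable def parQ {F : Type} [Field F] (T B β : ℕ) (D : ℤ → ℕ → F) (j : ℕ) (i : ℤ) : F :=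
  par1 T B D j i + par2 T B β D j (i - T - B)

theorem par1_zero {F : Type} [Field F] (T B : ℕ) (hBT : B ≤ T) (D : ℤ → ℕ → F) (j : ℕ) (i : ℤ)
    (hj : j < B)
    (h : ∀ t l, i - T ≤ t → t < i → l < T → D t l = 0) : par1 T B D j i = 0 := by
  unfold par1
  rw [h _ _ (by omega) (by omega) (by omega), zero_add]
  apply Finset.sum_eq_zero
  intro m hm
  rw [Finset.mem_range] at hm
  rw [h _ _ (by omega) (by omega) (by omega), mul_zero]

theorem par2_zero {F : Type} [Field F] (T B β : ℕ) (hBT : B ≤ T) (D : ℤ → ℕ → F) (j : ℕ) (i : ℤ)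
    (hj : j < B)
    (h0 : D (i - β * T) (T - 1 - j) = 0)
    (h : ∀ l : ℕ, l + B < T → D (i - β * (l + 1 + j)) l = 0) : par2 T B β D j i = 0 := by
  unfold par2
  rw [h0, zero_add]
  apply Finset.sum_eq_zero
  intro m hm
  rw [Finset.mem_range] at hm
  have := h (T - 1 - (B + m)) (by omega)
  have e : ((T - 1 - (B + m) : ℕ) : ℤ) = T - 1 - (B + m) := by omega
  rw [e] at this
  rw [show (i - β * (T + j) + β * (B + m : ℕ) : ℤ) = i - β * ((T - 1 - (B + m)) + 1 + j) by
    push_cast; ring, this, mul_zero]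

theorem c1_diag {F : Type} [Field F] (T B : ℕ) (hBT : B ≤ T)
    (hinj : Set.InjOn (fun i : ℕ => (i : F)) (Finset.range (T - B + B) : Set ℕ))
    (D : ℤ → ℕ → F) (i c : ℤ) (l : ℕ) (hl : l < T) (hil : c ≤ i + l)
    (h1 : ∀ k : ℕ, k < T → i + k < c → D (i + k) k = 0)
    (h2 : ∀ k : ℕ, k < T → c + B ≤ i + k → D (i + k) k = 0)
    (h3 : ∀ j : ℕ, j < B → c + B ≤ i + T + j → (i + j < c ∨ j = l) →
      par1 T B D j (i + T + j) = 0) : D (i + l) l = 0 := by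
  have hpar : ∀ j : ℕ, par1 T B D j (i + T + j) =
      D (i + j) j + ∑ m ∈ Finset.range (T - B),
        rsCoef F (T - B) m j * D (i + (B + m : ℕ)) (B + m) := by
    intro j
    unfold par1
    congr 1
    · congr 1; ring
    · apply Finset.sum_congr rfl
      intro m _
      congr 2
      ring
  have hv := v_lemma F T B hBT hinj (fun k => D (i + k) k) (c - i)
    (fun j hj hj' => h1 j (by omega) (by omega))
    (fun k _ hk hk' => h1 k hk (by omega))
    (fun k _ hk hk' => h2 k hk (by omega))
    (fun j hj hj1 hj2 => by
      rw [← h3 j hj (by omega) (by omega), hpar])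
  by_cases hlB : B ≤ l
  · exact hv l hlB hl
  · have := h3 l (by omega) (by omega) (Or.inr rfl)
    rw [hpar, Finset.sum_eq_zero, add_zero] at this
    · exact this
    · intro m hm
      rw [Finset.mem_range] at hm
      have := hv (B + m) (by omega) (by omega)
      rw [this, mul_zero]

theorem user1 {F : Type} [Field F] (T B β : ℕ) (hBT : B ≤ T)
    (hinj : Set.InjOn (fun i : ℕ => (i : F)) (Finset.range (T - B + B) : Set ℕ))
    (D : ℤ → ℕ → F) (c t : ℤ) (ht : c ≤ t) (ht' : t < c + B)
    (h0 : ∀ t' l, t' < c → l < T → D t' l = 0)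
    (h1 : ∀ t' l, c + B ≤ t' → t' ≤ t + T → l < T → D t' l = 0)
    (h2 : ∀ j i, j < B → c + B ≤ i → i ≤ t + T → parQ T B β D j i = 0) :
    ∀ l, l < T → D t l = 0 := by
  intro l hl
  have := c1_diag T B hBT hinj D (t - l) c l hl (by omega)
    (fun k hk hk' => h0 _ _ hk' hk)
    (fun k hk hk' => h1 _ _ hk' (by omega) hk)
    (by
      intro j hj hj1 hj2
      have hq := h2 j (t - l + T + j) hj hj1 (by omega)
      unfold parQ at hq
      rw [par2_zero T B β hBT D j _ hj, add_zero] at hq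
      · exact hq
      · apply h0 _ _ _ (by omega)
        have : (0 : ℤ) ≤ β * T := by positivity
        omega
      · intro l' hl'
        apply h0 _ _ _ (by omega)
        have : (0 : ℤ) ≤ β * (l' + 1 + j) := by positivity
        omega)
  simpa using this

theorem step1 {F : Type} [Field F] (T B β : ℕ) (hBT : B ≤ T) (hβ : 1 ≤ β)
    (hinj : Set.InjOn (fun i : ℕ => (i : F)) (Finset.range (T - B + B) : Set ℕ))
    (D : ℤ → ℕ → F)
    (h0 : ∀ t l, t < 0 → l < T → D t l = 0)
    (h1 : ∀ t l, (β : ℤ) * B + B ≤ t → t ≤ β * T + T + B → l < T → D t l = 0)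
    (h2 : ∀ j i, j < B → (β : ℤ) * B + B ≤ i → i ≤ β * T + T + B → parQ T B β D j i = 0)
    (w : ℤ)
    (ih : ∀ (t : ℤ) (l : ℕ), l + B < T → t < β * B → t + l * β < w → D t l = 0)
    (t : ℤ) (l : ℕ) (hl : l + B < T) (ht : (β : ℤ) * B ≤ t) (ht' : t < β * B + B)
    (hw : t + l * β = w) : D t l = 0 := by
  have hBTβ : (β : ℤ) * B ≤ β * T := by
    apply mul_le_mul_of_nonneg_left <;> omega
  have hβ0 : (0 : ℤ) ≤ (β : ℤ) - 1 := by omega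
  have hlβ : (0 : ℤ) ≤ l * β := by positivity
  have := c1_diag T B hBT hinj D (t - l) (β * B) l (by omega) (by omega)
    (by
      intro k hk hk'
      apply ih _ _ (by omega) hk'
      have : (k : ℤ) * β ≤ l * β := by
        apply mul_le_mul_of_nonneg_right <;> omega
      omega)
    (fun k hk hk' => h1 _ _ hk' (by omega) hk)
    (by
      intro j hj hj1 hj2
      have hq := h2 j (t - l + T + j) hj hj1 (by omega)
      unfold parQ at hq
      rw [par2_zero T B β hBT D j _ hj, add_zero] at hq
      · exact hq
      · apply h0 _ _ _ (by omega)
        omega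
      · intro l' hl'
        have e : (β : ℤ) * (l' + 1 + j) = l' * β + β + β * j := by ring
        have e1 : (j : ℤ) ≤ β * j := by nlinarith
        have e2 : (0 : ℤ) ≤ l' * β := by positivity
        apply ih _ _ hl'
        · omega
        · omega)
  simpa using this

theorem claimA {F : Type} [Field F] (T B β : ℕ) (hBT : B ≤ T) (hβ : 1 ≤ β)
    (hinj : Set.InjOn (fun i : ℕ => (i : F)) (Finset.range (T - B + B) : Set ℕ))
    (D : ℤ → ℕ → F)
    (h0 : ∀ t l, t < 0 → l < T → D t l = 0)
    (h1 : ∀ t l, (β : ℤ) * B + B ≤ t → t ≤ β * T + T + B → l < T → D t l = 0)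
    (h2 : ∀ j i, j < B → (β : ℤ) * B + B ≤ i → i ≤ β * T + T + B → parQ T B β D j i = 0) :
    ∀ (w : ℕ) (t : ℤ) (l : ℕ), l + B < T → t < β * B → t + l * β = w → D t l = 0 := by
  have hBTβ : (β : ℤ) * B ≤ β * T := by
    apply mul_le_mul_of_nonneg_left <;> omega
  intro w
  induction w using Nat.strong_induction_on with
  | _ w ihw =>
  have ih : ∀ (t : ℤ) (l : ℕ), l + B < T → t < β * B → t + l * β < w → D t l = 0 := by
    intro t l hl ht hw
    rcases lt_or_ge t 0 with h | h
    · exact h0 t l h (by omega)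
    · have : 0 ≤ t + l * β := by positivity
      exact ihw (t + l * β).toNat (by omega) t l hl ht (by omega)
  have hs1 := step1 T B β hBT hβ hinj D h0 h1 h2 w ih
  intro t l hl ht hw
  -- position of the diagonal
  obtain ⟨i, hi⟩ : ∃ i : ℤ, i = w - (T - 1) * β := ⟨_, rfl⟩
  have hwT : (w : ℤ) < β * T := by
    have : (l : ℤ) * β ≤ (T - 1 - B) * β := by
      apply mul_le_mul_of_nonneg_right <;> omega
    nlinarith
  -- first index with nonnegative time
  obtain ⟨e, he⟩ : ∃ e : ℤ, ∀ k : ℤ, i + k * β < 0 ↔ k < e := by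
    refine ⟨-(i / β), fun k => ?_⟩
    have hβ' : (0 : ℤ) < β := by omega
    have := Int.ediv_lt_iff_lt_mul (a := i) (b := -k) hβ'
    constructor
    · intro h
      have := this.2 (by linarith)
      omega
    · intro h
      have := this.1 (by omega)
      linarith
  have hval : ∀ k : ℕ, k < T → i + k * β + (T - 1 - k : ℕ) * β = w := by
    intro k hk
    rw [show ((T - 1 - k : ℕ) : ℤ) = T - 1 - k by omega, hi]
    ring
  have hpar : ∀ j : ℕ, par2 T B β D j (i + (T + j) * β) =
      D (i + j * β) (T - 1 - j) + ∑ m ∈ Finset.range (T - B),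
        rsCoef F (T - B) m j * D (i + (B + m : ℕ) * β) (T - 1 - (B + m)) := by
    intro j
    unfold par2
    congr 1
    · congr 1; ring
    · apply Finset.sum_congr rfl
      intro m _
      congr 2
      ring
  have hv := v_lemma F T B hBT hinj (fun k => D (i + k * β) (T - 1 - k)) e
    (fun j hj hj' => h0 _ _ ((he j).2 hj') (by omega))
    (fun k _ hk hk' => h0 _ _ ((he k).2 hk') (by omega))
    (by
      intro k hBk hk hk'
      have ht0 : (β : ℤ) * B ≤ i + k * β := by
        have := (he (k - B)).not.2 (by omega)
        linarith
      have hv := hval k hk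
      by_cases hc : i + k * β < β * B + B
      · exact hs1 _ _ (by omega) ht0 hc hv
      · have : (0 : ℤ) ≤ (T - 1 - k : ℕ) * β := by positivity
        exact h1 _ _ (by omega) (by omega) (by omega))
    (by
      intro j hj hj1 hj2
      rw [← hpar]
      have hz1 : (β : ℤ) * B ≤ i + (T + j) * β := by
        have := (he (T + j - B)).not.2 (by omega)
        linarith
      have hz2 : i + (T + j) * β < β * T := by
        have := (he j).2 hj2
        linarith
      have hq := h2 j (i + (T + j) * β + T + B) hj (by omega) (by omega)
      unfold parQ at hq
      rw [par1_zero T B hBT D j _ hj, zero_add] at hq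
      · rw [← hq]
        congr 1
        ring
      · intro t' l' ht1 ht2 hl'
        exact h1 _ _ (by omega) (by omega) hl')
  have := hv (T - 1 - l) (by omega) (by omega)
  rw [show T - 1 - (T - 1 - l) = l by omega, show ((T - 1 - l : ℕ) : ℤ) = T - 1 - l by omega,
    hi] at this
  rw [← this]
  congr 1
  rw [← hw]
  ring

theorem user2 {F : Type} [Field F] (T B β : ℕ) (hBT : B ≤ T) (hβ : 1 ≤ β)
    (hinj : Set.InjOn (fun i : ℕ => (i : F)) (Finset.range (T - B + B) : Set ℕ))
    (D : ℤ → ℕ → F) (t : ℤ) (ht : 0 ≤ t) (ht' : t < β * B + B)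
    (h0 : ∀ t l, t < 0 → l < T → D t l = 0)
    (h1 : ∀ t' l, (β : ℤ) * B + B ≤ t' → t' ≤ t + (β * T + T + B) → l < T → D t' l = 0)
    (h2 : ∀ j i, j < B → (β : ℤ) * B + B ≤ i → i ≤ t + (β * T + T + B) →
      parQ T B β D j i = 0) :
    ∀ l, l < T → D t l = 0 := by
  have hBTβ : (β : ℤ) * B ≤ β * T := by
    apply mul_le_mul_of_nonneg_left <;> omega
  have h1' : ∀ t l, (β : ℤ) * B + B ≤ t → t ≤ β * T + T + B → l < T → D t l = 0 :=
    fun t' l a b c => h1 t' l a (by omega) c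
  have h2' : ∀ j i, j < B → (β : ℤ) * B + B ≤ i → i ≤ β * T + T + B →
      parQ T B β D j i = 0 := fun j i a b c => h2 j i a b (by omega)
  have hA : ∀ (t : ℤ) (l : ℕ), l + B < T → t < β * B → D t l = 0 := by
    intro t l hl ht
    rcases lt_or_ge t 0 with h | h
    · exact h0 t l h (by omega)
    · have : 0 ≤ t + l * β := by positivity
      exact claimA T B β hBT hβ hinj D h0 h1' h2' (t + l * β).toNat t l hl ht (by omega)
  have hA' : ∀ (t : ℤ) (l : ℕ), l + B < T → t < β * B + B → D t l = 0 := by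
    intro t l hl ht
    rcases lt_or_ge t (β * B) with h | h
    · exact hA t l hl h
    · exact step1 T B β hBT hβ hinj D h0 h1' h2' (t + l * β) (fun t l a b _ => hA t l a b)
        t l hl h ht rfl
  -- everything before `β * B`
  have hfirst : ∀ t' : ℤ, 0 ≤ t' → t' < β * B → t' ≤ t → ∀ l, l < T → D t' l = 0 := by
    intro t' ht0 ht1 ht2 l hl
    by_cases hlB : l + B < T
    · exact hA t' l hlB ht1
    · have hq := h2 (T - 1 - l) (t' + (β * T + T + B)) (by omega) (by omega) (by omega)
      unfold parQ at hq
      rw [par1_zero T B hBT D _ _ (by omega), zero_add] at hq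
      · unfold par2 at hq
        rw [Finset.sum_eq_zero, add_zero] at hq
        · rw [← hq, show T - 1 - (T - 1 - l) = l by omega]
          congr 1
          ring
        · intro m hm
          rw [Finset.mem_range] at hm
          obtain ⟨z, hz⟩ : ∃ z : ℤ, z = (t' + (β * T + T + B) - T - B
            - β * (T + (T - 1 - l : ℕ)) + β * (B + m : ℕ)) := ⟨_, rfl⟩
          rw [← hz]
          have hzle : z ≤ t' + β * T := by
            have : (β : ℤ) * (B + m : ℕ) ≤ β * (T + (T - 1 - l : ℕ)) := by
              apply mul_le_mul_of_nonneg_left <;> omega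
            omega
          have : D z (T - 1 - (B + m)) = 0 := by
            by_cases hc : z < β * B + B
            · exact hA' _ _ (by omega) hc
            · exact h1 _ _ (by omega) (by omega) (by omega)
          rw [this, mul_zero]
      · intro t'' l'' ha hb hl''
        exact h1 _ _ (by omega) (by omega) hl''
  rcases lt_or_ge t (β * B) with h | h
  · exact hfirst t ht h le_rfl
  · have hx : (0 : ℤ) ≤ β * T := by positivity
    apply user1 T B β hBT hinj D (β * B) t h ht'
    · intro t' l hc hl
      rcases lt_or_ge t' 0 with h' | h'
      · exact h0 t' l h' hl
      · exact hfirst t' h' hc (by omega) l hl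
    · intro t' l a b c
      exact h1 t' l a (by omega) c
    · intro j i a b c
      exact h2 j i a b (by omega)

theorem parQ_sub {F : Type} [Field F] (T B β : ℕ) (D D' : ℤ → ℕ → F) (j : ℕ) (i : ℤ) :
    parQ T B β (fun t l => D t l - D' t l) j i = parQ T B β D j i - parQ T B β D' j i := by
  unfold parQ par1 par2
  simp only [mul_sub, Finset.sum_sub_distrib]
  ring

theorem parQ_shift {F : Type} [Field F] (T B β : ℕ) (D : ℤ → ℕ → F) (c : ℤ) (j : ℕ) (i : ℤ) :
    parQ T B β (fun t l => D (t + c) l) j i = parQ T B β D j (i + c) := by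
  unfold parQ par1 par2
  congr 1
  · congr 1
    · ring_nf
    · apply Finset.sum_congr rfl
      intro m _
      ring_nf
  · congr 1
    · ring_nf
    · apply Finset.sum_congr rfl
      intro m _
      ring_nf

theorem parQ_congr {F : Type} [Field F] (T B β : ℕ) (hBT : B ≤ T) (D D' : ℤ → ℕ → F) (j : ℕ)
    (i : ℤ) (hj : j < B) (h : ∀ t l, t ≤ i → l < T → D t l = D' t l) :
    parQ T B β D j i = parQ T B β D' j i := by
  rw [← sub_eq_zero, ← parQ_sub]
  unfold parQ
  rw [par1_zero T B hBT _ _ _ hj, par2_zero T B β hBT _ _ _ hj, add_zero]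
  · have : (0 : ℤ) ≤ β * T := by positivity
    rw [h _ _ (by omega) (by omega), sub_self]
  · intro l hl
    have : (0 : ℤ) ≤ β * (l + 1 + j) := by positivity
    rw [h _ _ (by omega) (by omega), sub_self]
  · intro t l ht ht' hl
    rw [h _ _ (by omega) (by omega), sub_self]

/-- A source stream, extended by zero to negative times. -/
def extStream {F : Type} [Field F] (T : ℕ) (s : ℕ → Fin T → F) (i : ℤ) (l : ℕ) : F :=
  if h : 0 ≤ i ∧ l < T then s i.toNat ⟨l, h.2⟩ else 0

/-- The streaming code. -/
noncomputable def dsCode (F : Type) [Field F] (T B β : ℕ) (t : ℕ)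
    (src : Fin (t + 1) → (Fin T → F)) : Fin (T + B) → F := fun c =>
  if hc : c.val < T then src (Fin.last t) ⟨c.val, hc⟩
  else parQ T B β (extStream T (fun τ => if h : τ < t + 1 then src ⟨τ, h⟩ else 0)) (c.val - T) t

theorem dsCode_eq {F : Type} [Field F] (T B β : ℕ) (hBT : B ≤ T) (s s' : ℕ → Fin T → F) (i : ℤ)
    (hi : 0 ≤ i)
    (h : chanStream (dsCode F T B β) s i.toNat = chanStream (dsCode F T B β) s' i.toNat) :
    (∀ l, l < T → extStream T s i l - extStream T s' i l = 0) ∧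
    (∀ j, j < B →
      parQ T B β (fun t l => extStream T s t l - extStream T s' t l) j i = 0) := by
  constructor
  · intro l hl
    have := congrFun h ⟨l, by omega⟩
    simp only [chanStream, dsCode, hl, dite_true, Fin.val_last] at this
    simp only [extStream, hi, hl, and_self, dite_true, this, sub_self]
  · intro j hj
    have := congrFun h ⟨T + j, by omega⟩
    simp only [chanStream, dsCode, show ¬ (T + j < T) by omega, dite_false,
      Nat.add_sub_cancel_left] at this
    rw [parQ_sub, sub_eq_zero]
    rw [show ((i.toNat : ℕ) : ℤ) = i by omega] at this
    have hh : ∀ s : ℕ → Fin T → F, parQ T B β (extStream T s) j i =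
        parQ T B β (extStream T (fun τ => if h : τ < i.toNat + 1 then s τ else 0)) j i := by
      intro s
      apply parQ_congr T B β hBT _ _ _ _ hj
      intro t l ht hl
      unfold extStream
      by_cases h0 : 0 ≤ t ∧ l < T
      · rw [dif_pos h0, dif_pos h0]
        dsimp only
        rw [dif_pos (by omega)]
      · rw [dif_neg h0, dif_neg h0]
    rw [hh s, hh s']
    exact this

theorem dsCode_corrects1 {F : Type} [Field F] (T B β : ℕ) (hB : 1 ≤ B) (hBT : B ≤ T)
    (hinj : Set.InjOn (fun i : ℕ => (i : F)) (Finset.range (T - B + B) : Set ℕ)) :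
    Corrects (dsCode F T B β) B T := by
  rw [corrects_iff _ _ _ hB]
  intro s s' c t h
  have hx : ∀ i : ℤ, 0 ≤ i → i ≤ t + T → (i < c ∨ (c : ℤ) + B ≤ i) → _ :=
    fun i hi hi1 hi2 => dsCode_eq (F := F) T B β hBT s s' i hi (h i.toNat (by omega) (by omega))
  have hneg : ∀ (i : ℤ) l, i < 0 → extStream T s i l - extStream T s' i l = 0 := by
    intro i l hi
    unfold extStream
    rw [dif_neg (by omega), dif_neg (by omega), sub_self]
  have goal : ∀ l, l < T → extStream T s t l - extStream T s' t l = 0 := by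
    by_cases hc : t < c ∨ c + B ≤ t
    · exact (hx t (by omega) (by omega) (by omega)).1
    · apply user1 T B β hBT hinj (fun t l => extStream T s t l - extStream T s' t l) c t
        (by omega) (by omega)
      · intro t' l ht' hl
        rcases lt_or_ge t' 0 with h' | h'
        · exact hneg _ _ h'
        · exact (hx t' h' (by omega) (by omega)).1 l hl
      · intro t' l ht' ht'' hl
        exact (hx t' (by omega) (by omega) (by omega)).1 l hl
      · intro j i hj hi hi'
        exact (hx i (by omega) (by omega) (by omega)).2 j hj
  funext l
  have := goal l.val l.isLt
  simpa [extStream, sub_eq_zero] using this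

theorem dsCode_corrects2 {F : Type} [Field F] (T B β : ℕ) (hB : 1 ≤ B) (hBT : B ≤ T)
    (hβ : 1 ≤ β)
    (hinj : Set.InjOn (fun i : ℕ => (i : F)) (Finset.range (T - B + B) : Set ℕ)) :
    Corrects (dsCode F T B β) (β * B + B) (β * T + T + B) := by
  rw [corrects_iff _ _ _ (by omega)]
  intro s s' c t h
  have hx : ∀ i : ℤ, 0 ≤ i → i ≤ t + (β * T + T + B) → (i < c ∨ (c : ℤ) + (β * B + B) ≤ i) → _ :=
    fun i hi hi1 hi2 => dsCode_eq (F := F) T B β hBT s s' i hi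
      (h i.toNat (by zify; rw [Int.toNat_of_nonneg hi]; exact hi1)
        (by zify; rw [Int.toNat_of_nonneg hi]; exact hi2))
  have hneg : ∀ (i : ℤ) l, i < 0 → extStream T s i l - extStream T s' i l = 0 := by
    intro i l hi
    unfold extStream
    rw [dif_neg (by omega), dif_neg (by omega), sub_self]
  have p1 : (0 : ℤ) ≤ β * B := by positivity
  have p2 : (0 : ℤ) ≤ β * T := by positivity
  have goal : ∀ l, l < T → extStream T s t l - extStream T s' t l = 0 := by
    by_cases hc : (t : ℤ) < c ∨ (c : ℤ) + (β * B + B) ≤ t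
    · exact (hx t (by omega) (by omega) (by omega)).1
    · have := user2 T B β hBT hβ hinj
        (fun t l => extStream T s (t + c) l - extStream T s' (t + c) l) (t - c)
        (by omega) (by omega)
        (by
          intro t' l ht' hl
          rcases lt_or_ge (t' + c) 0 with h' | h'
          · exact hneg _ _ h'
          · exact (hx (t' + c) h' (by omega) (by omega)).1 l hl)
        (by
          intro t' l ht' ht'' hl
          exact (hx (t' + c) (by omega) (by omega) (by omega)).1 l hl)
        (by
          intro j i hj hi hi'
          have := (hx (i + c) (by omega) (by omega) (by omega)).2 j hj
          rwa [← parQ_shift] at this)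
      simpa using this
  funext l
  have := goal l.val l.isLt
  simpa [extStream, sub_eq_zero] using this

theorem stmt_0 (B T α : ℕ) (hB : 1 ≤ B) (hBT : B ≤ T) (hα : 2 ≤ α) :
    IsLeast {T₂ : ℕ |
      ∃ (F : Type) (_ : Field F) (_ : Fintype F) (k n : ℕ),
        0 < k ∧ 0 < n ∧ (T : ℚ) / ((T : ℚ) + (B : ℚ)) ≤ (k : ℚ) / (n : ℚ) ∧
        ∃ f : ∀ t : ℕ, (Fin (t + 1) → (Fin k → F)) → (Fin n → F),
          Corrects f B T ∧ Corrects f (α * B) T₂}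
      (α * T + B) := by
  obtain ⟨β, rfl⟩ : ∃ β, α = β + 1 := ⟨α - 1, by omega⟩
  have hβ : 1 ≤ β := by omega
  constructor
  · obtain ⟨p, hp, hpp⟩ := Nat.exists_infinite_primes (T + 1)
    have : Fact p.Prime := ⟨hpp⟩
    have hinj : Set.InjOn (fun i : ℕ => (i : ZMod p)) (Finset.range (T - B + B) : Set ℕ) := by
      intro a ha b hb hab
      simp only [Finset.coe_range, Set.mem_Iio] at ha hb
      have := (ZMod.natCast_eq_natCast_iff' a b p).1 hab
      rwa [Nat.mod_eq_of_lt (by omega), Nat.mod_eq_of_lt (by omega)] at this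
    refine ⟨ZMod p, inferInstance, inferInstance, T, T + B, by omega, by omega, ?_,
      dsCode (ZMod p) T B β, dsCode_corrects1 T B β hB hBT hinj, ?_⟩
    · push_cast; exact le_rfl
    · have := dsCode_corrects2 T B β hB hBT hβ hinj
      rwa [show (β + 1) * B = β * B + B by ring, show (β + 1) * T = β * T + T by ring]
  · rintro T₂ ⟨F, _, _, k, n, hk, hn, hrate, f, h1, h2⟩
    by_contra hlt
    push Not at hlt
    have hBpos : 1 ≤ (β + 1) * B := by nlinarith
    have hrate' : T * n ≤ k * (T + B) := by
      rw [div_le_div_iff₀ (by positivity) (by positivity)] at hrate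
      exact_mod_cast hrate
    refine converse_aux B T β hB hBT hβ F k n hn hrate' f h1 ?_
    rw [corrects_iff _ _ _ hBpos] at h2 ⊢
    intro s s' j t h
    exact h2 s s' j t (fun i hi => h i (by omega))
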